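/- Let X be a compact metric space with its Borel σ-algebra, μ and ν Borel probability measures on X, c : X × X → ℝ continuous and nonnegative, ε > 0, and D : X → ℝ continuous. Define the (c,ε)-transform D^{(c,ε)}(x) = −ε·log ∫ exp((D(y)−c(x,y))/ε) dν(y). Then the supremum over bounded Borel measurable D₁ : X → ℝ of [∫ D₁ dμ − ε·∫∫ exp((D₁(x)+D(y)−c(x,y))/ε) dμ(x) dν(y)] equals ∫ D^{(c,ε)} dμ − ε, and it is attained at D₁ = D^{(c,ε)}. -/

import Mathlib

open MeasureTheory Real

/-- On a compact space, integrating a jointly continuous function over one variable yields a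
continuous function of the other. -/
theorem continuous_integral_right_of_compactSpace
    {X Y : Type*} [TopologicalSpace X] [FirstCountableTopology X] [LocallyCompactSpace X]
    [TopologicalSpace Y] [CompactSpace Y] [SecondCountableTopologyEither Y ℝ]
    [MeasurableSpace Y] [OpensMeasurableSpace Y]
    (ν : Measure Y) [IsFiniteMeasure ν] {f : X → Y → ℝ} (hf : Continuous (Function.uncurry f)) :
    Continuous fun x => ∫ y, f x y ∂ν := by
  simpa using continuous_parametric_integral_of_continuous (μ := ν) hf isCompact_univ

/-- The tangent-line inequality for `exp`, rescaled by `ε`. -/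
theorem sub_mul_exp_sub_div_le {ε : ℝ} (hε : 0 < ε) (a b : ℝ) :
    a - ε * Real.exp ((a - b) / ε) ≤ b - ε := by
  have h := mul_le_mul_of_nonneg_left (Real.add_one_le_exp ((a - b) / ε)) hε.le
  rw [mul_add, mul_div_cancel₀ _ hε.ne'] at h
  linarith

/-- Shifting the exponent by `a` in the soft minimum amounts to comparing `a` with the
soft minimum itself. -/
theorem integral_exp_add_div_eq {Y : Type*} [MeasurableSpace Y] {ν : Measure Y} {ε : ℝ}
    (hε : 0 < ε) {g : Y → ℝ} (hg : 0 < ∫ y, Real.exp (g y / ε) ∂ν) (a : ℝ) :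
    ∫ y, Real.exp ((a + g y) / ε) ∂ν
      = Real.exp ((a - -ε * Real.log (∫ y, Real.exp (g y / ε) ∂ν)) / ε) := by
  have h : (a - -ε * Real.log (∫ y, Real.exp (g y / ε) ∂ν)) / ε
      = a / ε + Real.log (∫ y, Real.exp (g y / ε) ∂ν) := by
    field_simp
    ring
  rw [h, Real.exp_add, Real.exp_log hg, ← integral_const_mul]
  simp only [add_div, Real.exp_add]

theorem c_eps_transform_partial_maximization
    {X : Type*} [MetricSpace X] [CompactSpace X] [MeasurableSpace X] [BorelSpace X]
    (μ ν : Measure X) [IsProbabilityMeasure μ] [IsProbabilityMeasure ν]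
    (c : X × X → ℝ) (hc : Continuous c) (hc0 : ∀ p, 0 ≤ c p)
    (ε : ℝ) (hε : 0 < ε)
    (D : X → ℝ) (hD : Continuous D)
    (Dce : X → ℝ)
    (hDce : ∀ x, Dce x = -ε * Real.log (∫ y, Real.exp ((D y - c (x, y)) / ε) ∂ν)) :
    (fun D₁ : X → ℝ => ∫ x, D₁ x ∂μ
        - ε * ∫ x, ∫ y, Real.exp ((D₁ x + D y - c (x, y)) / ε) ∂ν ∂μ) Dce
      = ∫ x, Dce x ∂μ - ε ∧
    IsGreatest
      {r : ℝ | ∃ D₁ : X → ℝ, Measurable D₁ ∧ (∃ M, ∀ x, |D₁ x| ≤ M) ∧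
        r = ∫ x, D₁ x ∂μ
          - ε * ∫ x, ∫ y, Real.exp ((D₁ x + D y - c (x, y)) / ε) ∂ν ∂μ}
      (∫ x, Dce x ∂μ - ε) := by
  have hcont : Continuous (Function.uncurry fun x y => Real.exp ((D y - c (x, y)) / ε)) := by
    simp only [Function.uncurry_def]
    fun_prop
  have hpos (x : X) : 0 < ∫ y, Real.exp ((D y - c (x, y)) / ε) ∂ν :=
    integral_exp_pos <| Continuous.integrable_of_hasCompactSupport (by fun_prop)
      (HasCompactSupport.of_compactSpace _)
  have hDce_cont : Continuous Dce := by
    rw [funext hDce]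
    exact continuous_const.mul
      ((continuous_integral_right_of_compactSpace ν hcont).log fun x => (hpos x).ne')
  have hinner (a : ℝ) (x : X) :
      ∫ y, Real.exp ((a + D y - c (x, y)) / ε) ∂ν = Real.exp ((a - Dce x) / ε) := by
    rw [hDce, ← integral_exp_add_div_eq hε (hpos x)]
    simp only [add_sub_assoc]
  obtain ⟨M, hM⟩ := isCompact_univ.exists_bound_of_continuousOn hDce_cont.continuousOn
  have hDce_bdd (x : X) : |Dce x| ≤ M := hM x (Set.mem_univ x)
  have hDce_int : Integrable Dce μ :=
    .of_bound hDce_cont.aestronglyMeasurable M (.of_forall hDce_bdd)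
  have hval : ∫ x, Dce x ∂μ
      - ε * ∫ x, ∫ y, Real.exp ((Dce x + D y - c (x, y)) / ε) ∂ν ∂μ
      = ∫ x, Dce x ∂μ - ε := by
    simp [hinner]
  refine ⟨hval, ⟨Dce, hDce_cont.measurable, ⟨M, hDce_bdd⟩, hval.symm⟩, ?_⟩
  rintro r ⟨D₁, hD₁, ⟨N, hN⟩, rfl⟩
  simp only [hinner]
  have hD₁_int : Integrable D₁ μ := .of_bound hD₁.aestronglyMeasurable N (.of_forall hN)
  have hexp_int : Integrable (fun x => Real.exp ((D₁ x - Dce x) / ε)) μ := by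
    refine .of_bound (((hD₁.sub hDce_cont.measurable).div_const ε).exp.aestronglyMeasurable)
      (Real.exp ((N + M) / ε)) (.of_forall fun x => ?_)
    rw [Real.norm_eq_abs, Real.abs_exp]
    gcongr
    linarith [(abs_le.mp (hN x)).2, (abs_le.mp (hDce_bdd x)).1]
  calc ∫ x, D₁ x ∂μ - ε * ∫ x, Real.exp ((D₁ x - Dce x) / ε) ∂μ
      = ∫ x, (D₁ x - ε * Real.exp ((D₁ x - Dce x) / ε)) ∂μ := by
        rw [integral_sub hD₁_int (hexp_int.const_mul ε), integral_const_mul]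
    _ ≤ ∫ x, (Dce x - ε) ∂μ :=
        integral_mono (hD₁_int.sub (hexp_int.const_mul ε)) (hDce_int.sub (integrable_const ε))
          fun x => sub_mul_exp_sub_div_le hε (D₁ x) (Dce x)
    _ = ∫ x, Dce x ∂μ - ε := by
        simp [integral_sub hDce_int (integrable_const ε)]
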